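/- A graph on 6 vertices is a minimum non-NIC-planar graph if and only if it is isomorphic to K₆ minus one edge; likewise, a graph on 6 vertices is a minimum non-IC-planar graph if and only if it is isomorphic to K₆ minus one edge. -/

import Mathlib

open Set

/-- Two subsets of the plane *properly cross* at a point `p`: in some open
neighbourhood of `p` the pair of sets looks, up to homeomorphism, like the two
coordinate axes meeting at the origin. -/
def ProperCross (A₁ A₂ : Set (ℝ × ℝ)) (p : ℝ × ℝ) : Prop :=
  ∃ U : Set (ℝ × ℝ), IsOpen U ∧ ∃ hp : p ∈ U, ∃ φ : U ≃ₜ (ℝ × ℝ),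
    φ ⟨p, hp⟩ = (0, 0) ∧
    (fun x => φ x) '' {x : U | (x : ℝ × ℝ) ∈ A₁} = {q : ℝ × ℝ | q.2 = 0} ∧
    (fun x => φ x) '' {x : U | (x : ℝ × ℝ) ∈ A₂} = {q : ℝ × ℝ | q.1 = 0}

/-- A drawing of a simple graph `G` in the plane: vertices go to distinct points,
each edge is drawn as a continuous injective arc joining the points of its two
endpoints, no arc passes through the point of a vertex other than its endpoints,
arcs of edges sharing an endpoint meet only at that common point, any two arcs
meet in finitely many points, every intersection point of two arcs that is not a
common endpoint is a proper crossing, and no point of the plane that is not a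
vertex point lies on more than two arcs. -/
structure Drawing {V : Type*} (G : SimpleGraph V) where
  pos : V → ℝ × ℝ
  pos_inj : Function.Injective pos
  arc : G.edgeSet → ℝ → ℝ × ℝ
  arc_cont : ∀ e, ContinuousOn (arc e) (Icc 0 1)
  arc_inj : ∀ e, InjOn (arc e) (Icc 0 1)
  arc_ends : ∀ e : G.edgeSet, ∃ u v : V, (e : Sym2 V) = s(u, v) ∧
    arc e 0 = pos u ∧ arc e 1 = pos v
  no_vertex_interior : ∀ (e : G.edgeSet) (v : V), v ∉ (e : Sym2 V) →
    pos v ∉ arc e '' Icc 0 1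
  shared_endpoint : ∀ e₁ e₂ : G.edgeSet, e₁ ≠ e₂ → ∀ v : V,
    v ∈ (e₁ : Sym2 V) → v ∈ (e₂ : Sym2 V) →
    arc e₁ '' Icc 0 1 ∩ arc e₂ '' Icc 0 1 ⊆ {pos v}
  finite_meet : ∀ e₁ e₂ : G.edgeSet, e₁ ≠ e₂ →
    (arc e₁ '' Icc 0 1 ∩ arc e₂ '' Icc 0 1).Finite
  proper : ∀ e₁ e₂ : G.edgeSet, e₁ ≠ e₂ →
    ∀ p ∈ arc e₁ '' Icc 0 1 ∩ arc e₂ '' Icc 0 1, p ∉ Set.range pos →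
    ProperCross (arc e₁ '' Icc 0 1) (arc e₂ '' Icc 0 1) p
  at_most_two : ∀ p : ℝ × ℝ, p ∉ Set.range pos →
    ∀ e₁ e₂ e₃ : G.edgeSet, p ∈ arc e₁ '' Icc 0 1 → p ∈ arc e₂ '' Icc 0 1 →
      p ∈ arc e₃ '' Icc 0 1 → e₁ = e₂ ∨ e₁ = e₃ ∨ e₂ = e₃

namespace Drawing

variable {V : Type*} {G : SimpleGraph V}

/-- The image of the arc drawn for the edge `e`. -/
def arcIm (D : Drawing G) (e : G.edgeSet) : Set (ℝ × ℝ) :=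
  D.arc e '' Icc 0 1

/-- The set of crossings of the drawing: points that are not vertex points and
lie on (at least, hence exactly) two arcs.  (An intersection point of two arcs
that is a common endpoint of the two edges is a vertex point, and conversely a
vertex point on two arcs is a common endpoint, so these are precisely the
intersection points of pairs of arcs that are not common endpoints.) -/
def crossings (D : Drawing G) : Set (ℝ × ℝ) :=
  {p | p ∉ Set.range D.pos ∧ ∃ e₁ e₂ : G.edgeSet, e₁ ≠ e₂ ∧ p ∈ D.arcIm e₁ ∧ p ∈ D.arcIm e₂}

/-- The number of crossings of the drawing. -/
noncomputable def crossingCount (D : Drawing G) : ℕ := D.crossings.ncard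

/-- The cluster set `S(c)` of a crossing `c`: the set of end-vertices of the
(two) edges whose arcs pass through `c`. -/
def cluster (D : Drawing G) (c : ℝ × ℝ) : Set V :=
  {v | ∃ e : G.edgeSet, c ∈ D.arcIm e ∧ v ∈ (e : Sym2 V)}

/-- A drawing is 1-planar if each edge's arc is crossed at most once. -/
def IsOnePlanar (D : Drawing G) : Prop :=
  ∀ e : G.edgeSet, {p | p ∈ D.crossings ∧ p ∈ D.arcIm e}.Subsingleton

/-- A drawing is NIC-planar if it is 1-planar and the cluster sets of any two
distinct crossings share at most one vertex. -/
def IsNICPlanar (D : Drawing G) : Prop :=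
  D.IsOnePlanar ∧ ∀ c₁ ∈ D.crossings, ∀ c₂ ∈ D.crossings, c₁ ≠ c₂ →
    (D.cluster c₁ ∩ D.cluster c₂).ncard ≤ 1

/-- A drawing is IC-planar if it is 1-planar and the cluster sets of any two
distinct crossings are disjoint. -/
def IsICPlanar (D : Drawing G) : Prop :=
  D.IsOnePlanar ∧ ∀ c₁ ∈ D.crossings, ∀ c₂ ∈ D.crossings, c₁ ≠ c₂ →
    D.cluster c₁ ∩ D.cluster c₂ = ∅

end Drawing

/-- A graph is 1-planar if it admits a 1-planar drawing. -/
def SimpleGraph.OnePlanar {V : Type*} (G : SimpleGraph V) : Prop :=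
  ∃ D : Drawing G, D.IsOnePlanar

/-- A graph is NIC-planar if it admits an NIC-planar drawing. -/
def SimpleGraph.NICPlanar {V : Type*} (G : SimpleGraph V) : Prop :=
  ∃ D : Drawing G, D.IsNICPlanar

/-- A graph is IC-planar if it admits an IC-planar drawing. -/
def SimpleGraph.ICPlanar {V : Type*} (G : SimpleGraph V) : Prop :=
  ∃ D : Drawing G, D.IsICPlanar

/-- The crossing number of `G`: the minimum number of crossings over all
drawings of `G`. -/
noncomputable def SimpleGraph.crossingNumber {V : Type*} (G : SimpleGraph V) : ℕ :=
  sInf {n | ∃ D : Drawing G, D.crossingCount = n}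
/-- The graph `H` is a minimum non-NIC-planar graph: `H` is not NIC-planar but
deleting any single edge of `H` yields an NIC-planar graph. -/
def MinNonNICPlanar {V : Type*} (H : SimpleGraph V) : Prop :=
  ¬ H.NICPlanar ∧ ∀ e ∈ H.edgeSet, (H.deleteEdges {e}).NICPlanar

/-- The graph `H` is a minimum non-IC-planar graph: `H` is not IC-planar but
deleting any single edge of `H` yields an IC-planar graph. -/
def MinNonICPlanar {V : Type*} (H : SimpleGraph V) : Prop :=
  ¬ H.ICPlanar ∧ ∀ e ∈ H.edgeSet, (H.deleteEdges {e}).ICPlanar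

/-- The complete multipartite graph with parts of sizes `a 0, …, a (k-1)`. -/
abbrev completeMultipartite {k : ℕ} (a : Fin k → ℕ) :
    SimpleGraph (Σ i : Fin k, Fin (a i)) :=
  SimpleGraph.completeMultipartiteGraph fun i => Fin (a i)

/-- `G` contains a subgraph isomorphic to `H`, i.e. there is an injective graph
homomorphism from `H` to `G`. -/
def ContainsSubgraphIso {V W : Type*} (G : SimpleGraph V) (H : SimpleGraph W) : Prop :=
  ∃ f : H →g G, Function.Injective f

/-- A continuous nonvanishing complex function on a simply connected space has a continuous
logarithm. -/
theorem exists_continuous_log {X : Type*} [TopologicalSpace X] [SimplyConnectedSpace X]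
    [LocallyPathConnectedSpace X] {F : X → ℂ} (hF : Continuous F) (h0 : ∀ z, F z ≠ 0) :
    ∃ L : X → ℂ, Continuous L ∧ ∀ z, Complex.exp (L z) = F z := by
  obtain ⟨x₀⟩ : Nonempty X := inferInstance
  obtain ⟨L, ⟨-, hL⟩, -⟩ := Complex.isCoveringMapOn_exp.existsUnique_continuousMap_lifts
    ⟨F, hF⟩ (Complex.exp_log (h0 x₀)) h0
  exact ⟨L, L.continuous, fun z => congr_fun hL z⟩

/-- Two continuous logarithms of the same function on `ℝ` have the same increments. -/
theorem increment_eq_of_exp_eq {L M : ℝ → ℂ} (hL : Continuous L) (hM : Continuous M)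
    (h : ∀ t, Complex.exp (L t) = Complex.exp (M t)) (s t : ℝ) : L t - L s = M t - M s := by
  have key : (fun t => M t + (L s - M s)) = L := by
    have hcov := Complex.isCoveringMap_exp
    refine hcov.eq_of_comp_eq (by fun_prop) hL ?_ s (by ring)
    funext u
    refine Subtype.ext ?_
    simp only [Function.comp_apply]
    rw [Complex.exp_add, Complex.exp_sub, h s, div_self (Complex.exp_ne_zero _), mul_one, h u]
  have := congr_fun key t
  rw [← this]
  ring

/-- The increment over `[0, 1]` of a continuous logarithm of `f`. -/
noncomputable def logIncrement (f : ℝ → ℂ) : ℂ :=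
  open Classical in
  if h : ∃ L : ℝ → ℂ, Continuous L ∧ ∀ t, Complex.exp (L t) = f t
  then h.choose 1 - h.choose 0 else 0

theorem logIncrement_eq {f L : ℝ → ℂ} (hL : Continuous L)
    (h : ∀ t, Complex.exp (L t) = f t) : logIncrement f = L 1 - L 0 := by
  have hex : ∃ L : ℝ → ℂ, Continuous L ∧ ∀ t, Complex.exp (L t) = f t := ⟨L, hL, h⟩
  rw [logIncrement, dif_pos hex]
  exact increment_eq_of_exp_eq hex.choose_spec.1 hL
    (fun t => (hex.choose_spec.2 t).trans (h t).symm) 0 1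

theorem exp_logIncrement {f : ℝ → ℂ} (hf : Continuous f) (h0 : ∀ t, f t ≠ 0) :
    Complex.exp (logIncrement f) = f 1 / f 0 := by
  obtain ⟨L, hL, h⟩ := exists_continuous_log hf h0
  rw [logIncrement_eq hL h, Complex.exp_sub, h, h]

/-- Going around the boundary of the unit square, the logarithm of `x s - y t` has total
increment zero. -/
theorem logIncrement_square {x y : ℝ → ℂ} (hx : Continuous x) (hy : Continuous y)
    (h : ∀ s t, x s ≠ y t) :
    logIncrement (fun s => x s - y 0) + logIncrement (fun t => y t - x 1) =
      logIncrement (fun s => x s - y 1) + logIncrement (fun t => y t - x 0) := by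
  obtain ⟨L, hL, hexp⟩ := exists_continuous_log (F := fun z : ℝ × ℝ => x z.1 - y z.2)
    (by fun_prop) (fun z => sub_ne_zero.2 (h _ _))
  have h1 (t : ℝ) : logIncrement (fun s => x s - y t) = L (1, t) - L (0, t) :=
    logIncrement_eq (L := fun s => L (s, t)) (by fun_prop) (fun s => hexp (s, t))
  have h2 (s : ℝ) : logIncrement (fun t => y t - x s) = L (s, 1) - L (s, 0) := by
    rw [logIncrement_eq (L := fun t => L (s, t) + Real.pi * Complex.I) (by fun_prop)]
    · ring
    · intro t
      rw [Complex.exp_add, hexp, Complex.exp_pi_mul_I]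
      ring
  rw [h1, h1, h2, h2]
  ring

theorem exists_int_of_exp_eq {z w : ℂ} (h : Complex.exp z = Complex.exp w) :
    ∃ n : ℤ, z = w + n * (2 * Real.pi * Complex.I) :=
  Complex.exp_eq_exp_iff_exists_int.1 h

/-- `K₃,₃` has no drawing in which vertex-disjoint edges are drawn disjointly. -/
theorem not_disjoint_arcs_completeBipartite (p q : Fin 3 → ℂ) (γ : Fin 3 → Fin 3 → ℝ → ℂ)
    (hγ : ∀ i j, Continuous (γ i j)) (h0 : ∀ i j, γ i j 0 = p i) (h1 : ∀ i j, γ i j 1 = q j)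
    (hp : ∀ i j k t, k ≠ i → γ i j t ≠ p k) (hq : ∀ i j k t, k ≠ j → γ i j t ≠ q k)
    (hd : ∀ i j i' j' s t, i ≠ i' → j ≠ j' → γ i j s ≠ γ i' j' t) : False := by
  have hpp : ∀ i k, i ≠ k → p i - p k ≠ 0 := fun i k hik => by
    rw [← h0 i 0]; exact sub_ne_zero.2 (hp i 0 k 0 hik.symm)
  have hqq : ∀ i k, i ≠ k → q i - q k ≠ 0 := fun i k hik => by
    rw [← h1 0 i]; exact sub_ne_zero.2 (hq 0 i k 1 hik.symm)
  have hpq : ∀ i j, p i - q j ≠ 0 := fun i j => by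
    obtain ⟨k, hk⟩ := exists_ne j
    rw [← h0 i k]; exact sub_ne_zero.2 (hq i k j 0 hk.symm)
  have hα : ∀ i k, i ≠ k → ∃ n : ℤ, Complex.log (p k - p i) =
      (Complex.log (p i - p k) + Real.pi * Complex.I) + n * (2 * Real.pi * Complex.I) := by
    intro i k hik
    apply exists_int_of_exp_eq
    rw [Complex.exp_add, Complex.exp_log (hpp _ _ hik), Complex.exp_log (hpp _ _ hik.symm),
      Complex.exp_pi_mul_I]
    ring
  have hβ : ∀ i k, i ≠ k → ∃ n : ℤ, Complex.log (q k - q i) =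
      (Complex.log (q i - q k) + Real.pi * Complex.I) + n * (2 * Real.pi * Complex.I) := by
    intro i k hik
    apply exists_int_of_exp_eq
    rw [Complex.exp_add, Complex.exp_log (hqq _ _ hik), Complex.exp_log (hqq _ _ hik.symm),
      Complex.exp_pi_mul_I]
    ring
  have hn : ∀ i j k, k ≠ i → ∃ n : ℤ, logIncrement (fun t => γ i j t - p k) =
      (Complex.log (p k - q j) + Real.pi * Complex.I - Complex.log (p i - p k))
        + n * (2 * Real.pi * Complex.I) := by
    intro i j k hk
    apply exists_int_of_exp_eq
    have := hγ i j
    rw [exp_logIncrement (by fun_prop) (fun t => sub_ne_zero.2 (hp i j k t hk)), h0, h1,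
      Complex.exp_sub, Complex.exp_add, Complex.exp_log (hpq _ _),
      Complex.exp_log (hpp _ _ hk.symm), Complex.exp_pi_mul_I]
    ring
  have hm : ∀ i j k, k ≠ j → ∃ n : ℤ, logIncrement (fun t => γ i j t - q k) =
      (Complex.log (q j - q k) - Complex.log (p i - q k)) + n * (2 * Real.pi * Complex.I) := by
    intro i j k hk
    apply exists_int_of_exp_eq
    have := hγ i j
    rw [exp_logIncrement (by fun_prop) (fun t => sub_ne_zero.2 (hq i j k t hk)), h0, h1,
      Complex.exp_sub, Complex.exp_log (hpq _ _), Complex.exp_log (hqq _ _ hk.symm)]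
  choose! α hα using hα
  choose! β hβ using hβ
  choose! n hn using hn
  choose! m hm using hm
  have h2π : (2 * Real.pi * Complex.I : ℂ) ≠ 0 := Complex.two_pi_I_ne_zero
  have hββ : ∀ j j', j ≠ j' → β j j' + β j' j + 1 = 0 := by
    intro j j' hj
    have e1 := hβ _ _ hj
    have e2 := hβ _ _ hj.symm
    have : ((β j j' + β j' j + 1 : ℤ) : ℂ) * (2 * Real.pi * Complex.I) = 0 := by
      push_cast
      linear_combination -e1 - e2
    exact_mod_cast (mul_eq_zero.1 this).resolve_right h2π
  have sq : ∀ i i' j j', i ≠ i' → j ≠ j' →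
      α i i' + β j j' + 1 + n i j i' + m i' j' j - m i j j' - n i' j' i = 0 := by
    intro i i' j j' hi hj
    have e := logIncrement_square (hγ i j) (hγ i' j') (fun s t => hd i j i' j' s t hi hj)
    rw [h0, h1, h0, h1, hn _ _ _ hi.symm, hm _ _ _ hj, hm _ _ _ hj.symm, hn _ _ _ hi] at e
    have e1 := hα _ _ hi
    have e2 := hβ _ _ hj
    have : ((α i i' + β j j' + 1 + n i j i' + m i' j' j - m i j j' - n i' j' i : ℤ) : ℂ)
        * (2 * Real.pi * Complex.I) = 0 := by
      push_cast
      linear_combination e - e1 - e2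
    exact_mod_cast (mul_eq_zero.1 this).resolve_right h2π
  have row : ∀ i i', i ≠ i' → ∃ z : ℤ,
      3 + (m i' 0 1 + m i' 0 2 + m i' 1 0 + m i' 1 2 + m i' 2 0 + m i' 2 1)
        - (m i 0 1 + m i 0 2 + m i 1 0 + m i 1 2 + m i 2 0 + m i 2 1) = 2 * z := by
    intro i i' hi
    have := sq i i' 0 1 hi (by decide)
    have := sq i i' 0 2 hi (by decide)
    have := sq i i' 1 0 hi (by decide)
    have := sq i i' 1 2 hi (by decide)
    have := sq i i' 2 0 hi (by decide)
    have := sq i i' 2 1 hi (by decide)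
    have := hββ 0 1 (by decide)
    have := hββ 0 2 (by decide)
    have := hββ 1 2 (by decide)
    refine ⟨n i' 0 i + n i' 1 i + n i' 2 i - n i 0 i' - n i 1 i' - n i 2 i' - 3 * α i i', ?_⟩
    linarith
  obtain ⟨z1, h1⟩ := row 0 1 (by decide)
  obtain ⟨z2, h2⟩ := row 0 2 (by decide)
  obtain ⟨z3, h3⟩ := row 1 2 (by decide)
  omega

/-! ### Elementary facts about drawings -/

namespace Drawing

variable {V W : Type*} {G : SimpleGraph V}

theorem mem_of_pos_mem_arcIm (D : Drawing G) (e : G.edgeSet) (v : V) :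
    D.pos v ∈ D.arcIm e → v ∈ (e : Sym2 V) := fun h => by
  by_contra hv
  exact D.no_vertex_interior e v hv h

/-- Two edges meeting at a vertex point share that vertex. -/
theorem mem_of_mem_range_pos (D : Drawing G) {e₁ e₂ : G.edgeSet} {p : ℝ × ℝ}
    (h₁ : p ∈ D.arcIm e₁) (h₂ : p ∈ D.arcIm e₂) (hp : p ∈ range D.pos) :
    ∃ v, v ∈ (e₁ : Sym2 V) ∧ v ∈ (e₂ : Sym2 V) := by
  obtain ⟨v, rfl⟩ := hp
  exact ⟨v, D.mem_of_pos_mem_arcIm _ _ h₁, D.mem_of_pos_mem_arcIm _ _ h₂⟩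

/-- The arc of an edge, parametrized on the whole line and oriented from `u` to `v`. -/
theorem exists_oriented_arc (D : Drawing G) {u v : V} (h : G.Adj u v) :
    ∃ γ : ℝ → ℝ × ℝ, Continuous γ ∧ γ 0 = D.pos u ∧ γ 1 = D.pos v ∧
      ∀ t, γ t ∈ D.arcIm ⟨s(u, v), h⟩ := by
  set e : G.edgeSet := ⟨s(u, v), h⟩
  have hc : Continuous (fun t => D.arc e (projIcc (0 : ℝ) 1 zero_le_one t)) :=
    (D.arc_cont e).comp_continuous (continuous_subtype_val.comp continuous_projIcc)
      (fun t => (projIcc (0 : ℝ) 1 zero_le_one t).2)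
  have hm : ∀ t, D.arc e (projIcc (0 : ℝ) 1 zero_le_one t) ∈ D.arcIm e :=
    fun t => mem_image_of_mem _ (projIcc (0 : ℝ) 1 zero_le_one t).2
  obtain ⟨a, b, hab, h0, h1⟩ := D.arc_ends e
  rcases Sym2.eq_iff.1 hab with ⟨rfl, rfl⟩ | ⟨rfl, rfl⟩
  · exact ⟨_, hc, by simpa using h0, by simpa using h1, hm⟩
  · exact ⟨_, hc.comp (continuous_const.sub continuous_id : Continuous fun t : ℝ => 1 - t),
      by simpa using h1, by simpa using h0, fun t => hm _⟩

/-- In every drawing of a graph containing `K₃,₃`, two vertex-disjoint edges of the `K₃,₃`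
meet. -/
theorem exists_meet_of_completeBipartite (D : Drawing G) {a b : Fin 3 → V}
    (ha : Function.Injective a) (hb : Function.Injective b) (h : ∀ i j, G.Adj (a i) (b j)) :
    ∃ i j i' j', i ≠ i' ∧ j ≠ j' ∧
      (D.arcIm ⟨s(a i, b j), h i j⟩ ∩ D.arcIm ⟨s(a i', b j'), h i' j'⟩).Nonempty := by
  by_contra! hcon
  choose γ hγ h0 h1 hm using fun i j => D.exists_oriented_arc (h i j)
  let ψ := Complex.equivRealProdCLM.symm
  have hψ : Function.Injective ψ := ψ.injective
  refine not_disjoint_arcs_completeBipartite (fun i => ψ (D.pos (a i)))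
    (fun j => ψ (D.pos (b j))) (fun i j t => ψ (γ i j t))
    (fun i j => ψ.continuous.comp (hγ i j)) (fun i j => by rw [h0]) (fun i j => by rw [h1])
    (fun i j k t hk he => ?_) (fun i j k t hk he => ?_) (fun i j i' j' s t hi hj he => ?_)
  · have := D.mem_of_pos_mem_arcIm ⟨s(a i, b j), h i j⟩ (a k) (hψ he ▸ hm i j t)
    rcases Sym2.mem_iff.1 this with h' | h'
    · exact hk (ha h')
    · exact (h k j).ne h'
  · have := D.mem_of_pos_mem_arcIm ⟨s(a i, b j), h i j⟩ (b k) (hψ he ▸ hm i j t)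
    rcases Sym2.mem_iff.1 this with h' | h'
    · exact (h i k).ne h'.symm
    · exact hk (hb h')
  · exact (hcon i j i' j' hi hj).subset ⟨hm i j s, hψ he ▸ hm i' j' t⟩

/-- The cluster set of a crossing has at least four elements. -/
theorem four_le_ncard_cluster [Finite V] (D : Drawing G) {c : ℝ × ℝ} (hc : c ∈ D.crossings) :
    4 ≤ (D.cluster c).ncard := by
  obtain ⟨hp, ⟨e₁, he₁⟩, ⟨e₂, he₂⟩, hne, h₁, h₂⟩ := hc
  have hdisj : ∀ v, v ∈ e₁ → v ∈ e₂ → False := fun v hv₁ hv₂ =>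
    hp ⟨v, (D.shared_endpoint _ _ hne v hv₁ hv₂ ⟨h₁, h₂⟩).symm⟩
  induction e₁ with | _ a b
  induction e₂ with | _ x y
  classical
  have hsub : (({a, b, x, y} : Finset V) : Set V) ⊆ D.cluster c := by
    intro v hv
    simp only [Finset.coe_insert, Finset.coe_singleton, mem_insert_iff, mem_singleton_iff] at hv
    rcases hv with rfl | rfl | rfl | rfl
    · exact ⟨_, h₁, by simp⟩
    · exact ⟨_, h₁, by simp⟩
    · exact ⟨_, h₂, by simp⟩
    · exact ⟨_, h₂, by simp⟩
  have hab : a ≠ b := he₁.ne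
  have hxy : x ≠ y := he₂.ne
  have hax : a ≠ x := fun h => hdisj a (by simp) (by simp [h])
  have hay : a ≠ y := fun h => hdisj a (by simp) (by simp [h])
  have hbx : b ≠ x := fun h => hdisj b (by simp) (by simp [h])
  have hby : b ≠ y := fun h => hdisj b (by simp) (by simp [h])
  have := ncard_le_ncard hsub (toFinite _)
  rw [ncard_coe_finset] at this
  simpa [hab, hxy, hax, hay, hbx, hby] using this

/-- On six vertices the cluster sets of two crossings share at least two vertices. -/
theorem crossings_subsingleton_of_isNICPlanar [Fintype V] (hV : Fintype.card V = 6)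
    (D : Drawing G) (h : D.IsNICPlanar) : D.crossings.Subsingleton := by
  intro c₁ h₁ c₂ h₂
  by_contra hne
  have h3 := h.2 c₁ h₁ c₂ h₂ hne
  have h4 := D.four_le_ncard_cluster h₁
  have h5 := D.four_le_ncard_cluster h₂
  have h6 := ncard_union_add_ncard_inter (D.cluster c₁) (D.cluster c₂)
  have h7 : (D.cluster c₁ ∪ D.cluster c₂).ncard ≤ 6 := by
    rw [← hV, ← Nat.card_eq_fintype_card]
    exact ncard_le_card _
  omega

theorem IsICPlanar.isNICPlanar {D : Drawing G} (h : D.IsICPlanar) : D.IsNICPlanar :=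
  ⟨h.1, fun c₁ h₁ c₂ h₂ hne => by simp [h.2 c₁ h₁ c₂ h₂ hne]⟩

theorem isICPlanar_of_crossings_subsingleton {D : Drawing G} (h : D.crossings.Subsingleton) :
    D.IsICPlanar :=
  ⟨fun _ _ hp _ hq => h hp.1 hq.1, fun _ h₁ _ h₂ hne => absurd (h h₁ h₂) hne⟩

theorem mem_range_pos_comp (D : Drawing G) {H : SimpleGraph W} (f : H →g G) (e : H.edgeSet)
    {p : ℝ × ℝ} (hp : p ∈ D.arcIm (f.mapEdgeSet e)) (h : p ∈ range D.pos) :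
    p ∈ range (D.pos ∘ f) := by
  obtain ⟨v, rfl⟩ := h
  obtain ⟨w, -, rfl⟩ := Sym2.mem_map.1 (D.mem_of_pos_mem_arcIm _ _ hp)
  exact ⟨w, rfl⟩

/-- The drawing of a subgraph obtained by restriction. -/
def comap (D : Drawing G) {H : SimpleGraph W} (f : H →g G) (hf : Function.Injective f) :
    Drawing H where
  pos := D.pos ∘ f
  pos_inj := D.pos_inj.comp hf
  arc e := D.arc (f.mapEdgeSet e)
  arc_cont e := D.arc_cont _
  arc_inj e := D.arc_inj _
  arc_ends := by
    rintro ⟨e, he⟩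
    induction e with | _ a b
    obtain ⟨u, v, huv, h0, h1⟩ := D.arc_ends (f.mapEdgeSet ⟨s(a, b), he⟩)
    have huv' : s(f a, f b) = s(u, v) := huv
    rcases Sym2.eq_iff.1 huv' with ⟨rfl, rfl⟩ | ⟨rfl, rfl⟩
    · exact ⟨a, b, rfl, h0, h1⟩
    · exact ⟨b, a, Sym2.eq_swap, h0, h1⟩
  no_vertex_interior e v hv := D.no_vertex_interior _ _ fun h => by
    obtain ⟨w, hw, hwv⟩ := Sym2.mem_map.1 h
    exact hv (hf hwv ▸ hw)
  shared_endpoint e₁ e₂ hne v h₁ h₂ := D.shared_endpoint _ _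
    ((SimpleGraph.Hom.mapEdgeSet.injective f hf).ne hne) _
    (Sym2.mem_map.2 ⟨v, h₁, rfl⟩) (Sym2.mem_map.2 ⟨v, h₂, rfl⟩)
  finite_meet e₁ e₂ hne := D.finite_meet _ _
    ((SimpleGraph.Hom.mapEdgeSet.injective f hf).ne hne)
  proper e₁ e₂ hne p hp hr := D.proper _ _
    ((SimpleGraph.Hom.mapEdgeSet.injective f hf).ne hne) p hp
    fun h => hr (D.mem_range_pos_comp f e₁ hp.1 h)
  at_most_two p hr e₁ e₂ e₃ h₁ h₂ h₃ := by
    have hinj := SimpleGraph.Hom.mapEdgeSet.injective f hf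
    simpa only [hinj.eq_iff] using
      D.at_most_two p (fun h => hr (D.mem_range_pos_comp f e₁ h₁ h)) _ _ _ h₁ h₂ h₃

theorem crossings_comap_subset (D : Drawing G) {H : SimpleGraph W} (f : H →g G)
    (hf : Function.Injective f) : (D.comap f hf).crossings ⊆ D.crossings := by
  rintro p ⟨hr, e₁, e₂, hne, h₁, h₂⟩
  exact ⟨fun h => hr (D.mem_range_pos_comp f e₁ h₁ h), f.mapEdgeSet e₁, f.mapEdgeSet e₂,
    (SimpleGraph.Hom.mapEdgeSet.injective f hf).ne hne, h₁, h₂⟩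

end Drawing

/-- `G` has a drawing with at most one crossing. -/
def HasOneCrossingDrawing {V : Type*} (G : SimpleGraph V) : Prop :=
  ∃ D : Drawing G, D.crossings.Subsingleton

theorem HasOneCrossingDrawing.comap {V W : Type*} {G : SimpleGraph V} {H : SimpleGraph W}
    (h : HasOneCrossingDrawing G) (f : H →g G) (hf : Function.Injective f) :
    HasOneCrossingDrawing H := by
  obtain ⟨D, hD⟩ := h
  exact ⟨D.comap f hf, hD.anti (D.crossings_comap_subset f hf)⟩

theorem nicPlanar_iff_hasOneCrossingDrawing {V : Type*} [Fintype V] (hV : Fintype.card V = 6)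
    (G : SimpleGraph V) : G.NICPlanar ↔ HasOneCrossingDrawing G :=
  ⟨fun ⟨D, hD⟩ => ⟨D, D.crossings_subsingleton_of_isNICPlanar hV hD⟩,
    fun ⟨D, hD⟩ => ⟨D, (Drawing.isICPlanar_of_crossings_subsingleton hD).isNICPlanar⟩⟩

theorem icPlanar_iff_hasOneCrossingDrawing {V : Type*} [Fintype V] (hV : Fintype.card V = 6)
    (G : SimpleGraph V) : G.ICPlanar ↔ HasOneCrossingDrawing G :=
  ⟨fun ⟨D, hD⟩ => ⟨D, D.crossings_subsingleton_of_isNICPlanar hV hD.isNICPlanar⟩,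
    fun ⟨D, hD⟩ => ⟨D, Drawing.isICPlanar_of_crossings_subsingleton hD⟩⟩

/-! ### `K₆` minus an edge needs two crossings -/

/-- Two distinct pairs of vertices of a six-element set are, up to relabelling, `01` and `02`,
or `01` and `34`. -/
theorem exists_labelling {V : Type*} [Fintype V] (hV : Fintype.card V = 6) {e₁ e₂ : Sym2 V}
    (h₁ : ¬ e₁.IsDiag) (h₂ : ¬ e₂.IsDiag) (hne : e₁ ≠ e₂) :
    ∃ σ : Fin 6 ≃ V, e₁ = s(σ 0, σ 1) ∧ (e₂ = s(σ 0, σ 2) ∨ e₂ = s(σ 3, σ 4)) := by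
  have extend : ∀ (s : Set (Fin 6)) (f : Fin 6 → V), InjOn f s →
      ∃ σ : Fin 6 ≃ V, ∀ i ∈ s, σ i = f i := by
    intro s f hf
    classical
    obtain ⟨g, hg⟩ := Set.MapsTo.exists_equiv_extend_of_card_eq (t := Finset.univ)
      (by simp [hV]) (s := s) (f := f) (fun _ _ => by simp) hf
    exact ⟨g.trans (Equiv.subtypeUnivEquiv (by simp)), hg⟩
  have share : ∀ a b c : V, a ≠ b → a ≠ c → b ≠ c →
      ∃ σ : Fin 6 ≃ V, σ 0 = a ∧ σ 1 = b ∧ σ 2 = c := by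
    intro a b c hab hac hbc
    obtain ⟨σ, hσ⟩ := extend {0, 1, 2} ![a, b, c, a, a, a] (by
      simp [InjOn, hab, hac, hbc, hab.symm, hac.symm, hbc.symm])
    exact ⟨σ, by simp [hσ], by simp [hσ], by simp [hσ]⟩
  induction e₁ with | _ a b
  induction e₂ with | _ c d
  rw [Sym2.mk_isDiag_iff] at h₁ h₂
  by_cases hac : a = c
  · subst hac
    obtain ⟨σ, rfl, rfl, rfl⟩ := share a b d h₁ h₂ (fun h => hne (by rw [h]))
    exact ⟨σ, rfl, .inl rfl⟩
  by_cases had : a = d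
  · subst had
    obtain ⟨σ, rfl, rfl, rfl⟩ := share a b c h₁ hac (fun h => hne (by rw [h, Sym2.eq_swap]))
    exact ⟨σ, rfl, .inl Sym2.eq_swap⟩
  by_cases hbc : b = c
  · subst hbc
    obtain ⟨σ, rfl, rfl, rfl⟩ := share b a d (Ne.symm h₁) h₂ had
    exact ⟨σ, Sym2.eq_swap, .inl rfl⟩
  by_cases hbd : b = d
  · subst hbd
    obtain ⟨σ, rfl, rfl, rfl⟩ := share b a c (Ne.symm h₁) (Ne.symm h₂) hac
    exact ⟨σ, Sym2.eq_swap, .inl Sym2.eq_swap⟩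
  obtain ⟨σ, hσ⟩ := extend {0, 1, 3, 4} ![a, b, a, c, d, a] (by
    simp [InjOn, h₁, h₂, hac, had, hbc, hbd, Ne.symm h₁, Ne.symm h₂, Ne.symm hac, Ne.symm had,
      Ne.symm hbc, Ne.symm hbd])
  refine ⟨σ, ?_, .inr ?_⟩ <;> simp [hσ]

theorem exists_ne_pair {V : Type*} [Fintype V] (hV : Fintype.card V = 6) (e : Sym2 V) :
    ∃ f : Sym2 V, ¬ f.IsDiag ∧ e ≠ f := by
  have σ : Fin 6 ≃ V := (Fintype.equivFinOfCardEq hV).symm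
  by_cases h : e = s(σ 0, σ 1)
  · exact ⟨s(σ 0, σ 2), by simp, by simp [h]⟩
  · exact ⟨s(σ 0, σ 1), by simp, h⟩

/-- A drawing with at most one crossing becomes crossing-free after deletion of an edge. -/
theorem Drawing.exists_edge_of_crossings_subsingleton {V : Type*} {G : SimpleGraph V}
    (D : Drawing G) (h : D.crossings.Subsingleton) :
    D.crossings = ∅ ∨ ∃ f ∈ G.edgeSet, ∀ e₁ e₂ : G.edgeSet, e₁ ≠ e₂ → (e₁ : Sym2 V) ≠ f →
      (e₂ : Sym2 V) ≠ f → D.arcIm e₁ ∩ D.arcIm e₂ ⊆ range D.pos := by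
  rcases D.crossings.eq_empty_or_nonempty with h0 | ⟨c, hc⟩
  · exact .inl h0
  obtain ⟨hr, f, f', -, hf, -⟩ := id hc
  refine .inr ⟨f, f.2, fun e₁ e₂ hne h₁ h₂ p hp => ?_⟩
  by_contra hpr
  have hpc : p ∈ D.crossings := ⟨hpr, e₁, e₂, hne, hp.1, hp.2⟩
  obtain rfl := h hpc hc
  rcases D.at_most_two p hpr e₁ e₂ f hp.1 hp.2 hf with h' | h' | h'
  · exact hne h'
  · exact h₁ (congrArg _ h')
  · exact h₂ (congrArg _ h')

theorem not_hasOneCrossingDrawing {V : Type*} [Fintype V] (hV : Fintype.card V = 6)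
    {G : SimpleGraph V} {e : Sym2 V} (he : ¬ e.IsDiag)
    (h : (⊤ : SimpleGraph V).deleteEdges {e} ≤ G) : ¬ HasOneCrossingDrawing G := by
  rintro ⟨D, hD⟩
  obtain ⟨f, hfd, hfe, hf⟩ : ∃ f : Sym2 V, ¬ f.IsDiag ∧ e ≠ f ∧
      ∀ e₁ e₂ : G.edgeSet, e₁ ≠ e₂ → (e₁ : Sym2 V) ≠ e → (e₂ : Sym2 V) ≠ e →
      (e₁ : Sym2 V) ≠ f → (e₂ : Sym2 V) ≠ f → D.arcIm e₁ ∩ D.arcIm e₂ ⊆ range D.pos := by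
    obtain ⟨g, hgd, hge⟩ := exists_ne_pair hV e
    rcases D.exists_edge_of_crossings_subsingleton hD with h0 | ⟨f, hfG, hf⟩
    · refine ⟨g, hgd, hge, fun e₁ e₂ hne _ _ _ _ p hp => ?_⟩
      by_contra hr
      exact h0.subset (show p ∈ D.crossings from ⟨hr, e₁, e₂, hne, hp.1, hp.2⟩)
    · by_cases hef : e = f
      · subst hef
        exact ⟨g, hgd, hge, fun e₁ e₂ hne h₁ h₂ _ _ => hf e₁ e₂ hne h₁ h₂⟩
      · exact ⟨f, G.not_isDiag_of_mem_edgeSet hfG, hef,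
          fun e₁ e₂ hne _ _ h₁ h₂ => hf e₁ e₂ hne h₁ h₂⟩
  obtain ⟨σ, rfl, hσ⟩ := exists_labelling hV he hfd hfe
  let a : Fin 3 → V := ![σ 0, σ 1, σ 2]
  let b : Fin 3 → V := ![σ 3, σ 4, σ 5]
  have hae : ∀ i j, s(a i, b j) ≠ s(σ 0, σ 1) := by
    intro i j
    fin_cases i <;> fin_cases j <;> simp [a, b]
  have haf : ∀ i j, s(a i, b j) ≠ f := by
    intro i j
    rcases hσ with rfl | rfl <;> fin_cases i <;> fin_cases j <;> simp [a, b]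
  have hab : ∀ i j, G.Adj (a i) (b j) := fun i j => h <| by
    rw [SimpleGraph.deleteEdges_adj]
    refine ⟨?_, hae i j⟩
    fin_cases i <;> fin_cases j <;> simp [a, b]
  have ha : Function.Injective a := by
    intro i j
    fin_cases i <;> fin_cases j <;> simp [a]
  have hb : Function.Injective b := by
    intro i j
    fin_cases i <;> fin_cases j <;> simp [b]
  obtain ⟨i, j, i', j', hi, hj, p, hp⟩ := D.exists_meet_of_completeBipartite ha hb hab
  have hne : (⟨s(a i, b j), hab i j⟩ : G.edgeSet) ≠ ⟨s(a i', b j'), hab i' j'⟩ := by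
    intro he
    rcases Sym2.eq_iff.1 (congrArg Subtype.val he) with ⟨h1, -⟩ | ⟨h1, -⟩
    · exact hi (ha h1)
    · exact (hab i j').ne h1
  obtain ⟨v, h1, h2⟩ := D.mem_of_mem_range_pos hp.1 hp.2
    (hf _ _ hne (hae _ _) (hae _ _) (haf _ _) (haf _ _) hp)
  rcases Sym2.mem_iff.1 h1 with rfl | rfl <;> rcases Sym2.mem_iff.1 h2 with h3 | h3
  · exact hi (ha h3)
  · exact (hab _ _).ne h3
  · exact (hab _ _).ne h3.symm
  · exact hj (hb h3)

/-! ### Straight-line drawings -/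

/-- Twice the signed area of the triangle `a b c`. -/
def orient {R : Type*} [CommRing R] (a b c : R × R) : R :=
  (b.1 - a.1) * (c.2 - a.2) - (b.2 - a.2) * (c.1 - a.1)

theorem exists_of_mem_segment {a b x : ℝ × ℝ} (h : x ∈ segment ℝ a b) :
    ∃ t ∈ Icc (0 : ℝ) 1, x.1 = a.1 + t * (b.1 - a.1) ∧ x.2 = a.2 + t * (b.2 - a.2) := by
  rw [segment_eq_image'] at h
  obtain ⟨t, ht, rfl⟩ := h
  exact ⟨t, ht, by simp, by simp⟩

theorem orient_eq_zero_of_mem_segment {a b x : ℝ × ℝ} (h : x ∈ segment ℝ a b) :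
    orient a b x = 0 := by
  obtain ⟨t, -, h1, h2⟩ := exists_of_mem_segment h
  rw [orient, h1, h2]
  ring

theorem disjoint_segment_of_orient {a b c d x : ℝ × ℝ}
    (h : 0 < orient a b c * orient a b d) (h₁ : x ∈ segment ℝ a b) (h₂ : x ∈ segment ℝ c d) :
    False := by
  have h0 := orient_eq_zero_of_mem_segment h₁
  obtain ⟨t, ⟨ht0, ht1⟩, e1, e2⟩ := exists_of_mem_segment h₂
  have key : orient a b x = (1 - t) * orient a b c + t * orient a b d := by
    rw [orient, orient, orient, e1, e2]
    ring
  rw [h0] at key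
  rcases pos_and_pos_or_neg_and_neg_of_mul_pos h with ⟨hc, hd⟩ | ⟨hc, hd⟩
  · nlinarith [mul_nonneg (sub_nonneg.2 ht1) hc.le, mul_nonneg ht0 hd.le]
  · nlinarith [mul_nonneg (sub_nonneg.2 ht1) (neg_pos.2 hc).le, mul_nonneg ht0 (neg_pos.2 hd).le]

theorem eq_of_mem_segment_of_mem_segment {a b c x : ℝ × ℝ} (h : orient a b c ≠ 0)
    (h₁ : x ∈ segment ℝ a b) (h₂ : x ∈ segment ℝ a c) : x = a := by
  have h0 := orient_eq_zero_of_mem_segment h₁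
  obtain ⟨t, -, e1, e2⟩ := exists_of_mem_segment h₂
  have key : orient a b x = t * orient a b c := by
    rw [orient, orient, e1, e2]
    ring
  obtain rfl := (mul_eq_zero.1 (key.symm.trans h0)).resolve_right h
  exact Prod.ext (by simpa using e1) (by simpa using e2)

theorem ProperCross.symm {A₁ A₂ : Set (ℝ × ℝ)} {p : ℝ × ℝ} (h : ProperCross A₁ A₂ p) :
    ProperCross A₂ A₁ p := by
  obtain ⟨U, hU, hp, φ, h0, h1, h2⟩ := h
  refine ⟨U, hU, hp, φ.trans (Homeomorph.prodComm ℝ ℝ), by simp [h0], ?_, ?_⟩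
  · have : (fun x => (φ.trans (Homeomorph.prodComm ℝ ℝ)) x) = Prod.swap ∘ fun x => φ x := rfl
    rw [this, image_comp, h2, image_swap_eq_preimage_swap]
    rfl
  · have : (fun x => (φ.trans (Homeomorph.prodComm ℝ ℝ)) x) = Prod.swap ∘ fun x => φ x := rfl
    rw [this, image_comp, h1, image_swap_eq_preimage_swap]
    rfl

theorem properCross_of_isOpenEmbedding {A₁ A₂ : Set (ℝ × ℝ)} {p : ℝ × ℝ}
    {f : ℝ × ℝ → ℝ × ℝ} (hf : Topology.IsOpenEmbedding f) (h0 : f (0, 0) = p)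
    (h₁ : ∀ q, f q ∈ A₁ ↔ q.2 = 0) (h₂ : ∀ q, f q ∈ A₂ ↔ q.1 = 0) : ProperCross A₁ A₂ p := by
  set φ := hf.isEmbedding.toHomeomorph.symm with hφ
  have hs : ∀ q, φ ⟨f q, mem_range_self q⟩ = q := fun q =>
    hf.isEmbedding.toHomeomorph.symm_apply_apply q
  have himg : ∀ A : Set (ℝ × ℝ),
      (fun x => φ x) '' {x : range f | (x : ℝ × ℝ) ∈ A} = {q | f q ∈ A} := by
    intro A
    ext q
    constructor
    · rintro ⟨⟨_, q', rfl⟩, hx, rfl⟩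
      change f (φ ⟨f q', mem_range_self q'⟩) ∈ A
      rw [hs]
      exact hx
    · exact fun hq => ⟨⟨f q, mem_range_self q⟩, hq, hs q⟩
  subst h0
  refine ⟨range f, hf.isOpen_range, mem_range_self _, φ, hs _, ?_, ?_⟩
  · rw [himg]
    exact Set.ext h₁
  · rw [himg]
    exact Set.ext h₂

theorem mem_segment_horizontal {a b : ℝ} (hab : a ≤ b) (q : ℝ × ℝ) :
    q ∈ segment ℝ ((a, 0) : ℝ × ℝ) (b, 0) ↔ q.1 ∈ Icc a b ∧ q.2 = 0 := by
  rw [← Prod.image_mk_segment_left, segment_eq_Icc hab]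
  constructor
  · rintro ⟨t, ht, rfl⟩
    exact ⟨ht, rfl⟩
  · exact fun h => ⟨q.1, h.1, Prod.ext rfl h.2.symm⟩

theorem mem_segment_vertical {a b : ℝ} (hab : a ≤ b) (q : ℝ × ℝ) :
    q ∈ segment ℝ ((0, a) : ℝ × ℝ) (0, b) ↔ q.2 ∈ Icc a b ∧ q.1 = 0 := by
  rw [← Prod.image_mk_segment_right, segment_eq_Icc hab]
  constructor
  · rintro ⟨t, ht, rfl⟩
    exact ⟨ht, rfl⟩
  · exact fun h => ⟨q.2, h.1, Prod.ext h.2.symm rfl⟩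

theorem properCross_segment_axes {a b c d : ℝ} (ha : a ≤ -1) (hb : 1 ≤ b) (hc : c ≤ -1)
    (hd : 1 ≤ d) : ProperCross (segment ℝ ((a, 0) : ℝ × ℝ) (b, 0))
      (segment ℝ ((0, c) : ℝ × ℝ) (0, d)) (0, 0) := by
  let k : ℝ → ℝ := fun t => Homeomorph.unitBall t
  have hk : Topology.IsOpenEmbedding k :=
    Metric.isOpen_ball.isOpenEmbedding_subtypeVal.comp Homeomorph.unitBall.isOpenEmbedding
  have hk0 : k 0 = 0 := Homeomorph.coe_unitBall_apply_zero
  have hk1 : ∀ t, k t ∈ Ioo (-1 : ℝ) 1 := fun t => by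
    have : k t ∈ Metric.ball (0 : ℝ) 1 := (Homeomorph.unitBall t).2
    rwa [Real.ball_eq_Ioo, zero_sub, zero_add] at this
  have hk2 : ∀ t, k t = 0 ↔ t = 0 := fun t =>
    ⟨fun h => hk.injective (h.trans hk0.symm), fun h => h ▸ hk0⟩
  refine properCross_of_isOpenEmbedding (hk.prodMap hk) (by simp [hk0]) (fun q => ?_)
    (fun q => ?_)
  · rw [mem_segment_horizontal (by linarith), Prod.map_fst, Prod.map_snd, hk2]
    have := hk1 q.1
    exact and_iff_right ⟨by linarith [this.1], by linarith [this.2]⟩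
  · rw [mem_segment_vertical (by linarith), Prod.map_fst, Prod.map_snd, hk2]
    have := hk1 q.2
    exact and_iff_right ⟨by linarith [this.1], by linarith [this.2]⟩

/-- The real point with given integer coordinates. -/
def toPlane (p : ℤ × ℤ) : ℝ × ℝ := (p.1, p.2)

theorem toPlane_injective : Function.Injective toPlane := by
  rintro ⟨a, b⟩ ⟨c, d⟩ h
  simpa [toPlane] using h

theorem orient_toPlane (a b c : ℤ × ℤ) :
    orient (toPlane a) (toPlane b) (toPlane c) = (orient a b c : ℤ) := by
  simp [orient, toPlane]

/-- The segment joining the images of the end-vertices of `e`. -/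
noncomputable def edgeSegment {V : Type*} (P : V → ℝ × ℝ) (e : Sym2 V) : Set (ℝ × ℝ) :=
  segment ℝ (P e.out.1) (P e.out.2)

theorem edgeSegment_mk {V : Type*} (P : V → ℝ × ℝ) (a b : V) :
    edgeSegment P s(a, b) = segment ℝ (P a) (P b) := by
  have h : s((s(a, b) : Sym2 V).out.1, (s(a, b) : Sym2 V).out.2) = s(a, b) := Quot.out_eq _
  rcases Sym2.eq_iff.1 h with ⟨h1, h2⟩ | ⟨h1, h2⟩
  · rw [edgeSegment, h1, h2]
  · rw [edgeSegment, h1, h2, segment_symm]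

section StraightLine

variable {V : Type*} {G : SimpleGraph V} {P : V → ℤ × ℤ} {w e n s : V}

/-- A placement of the vertices at integer points in general position such that the only pair of
straight edges that may cross is `we`, `sn`, whose segments lie on the coordinate axes. -/
structure AxisCrossing (G : SimpleGraph V) (P : V → ℤ × ℤ) (w e s n : V) : Prop where
  inj : Function.Injective P
  west : (P w).1 ≤ -1 ∧ (P w).2 = 0
  east : 1 ≤ (P e).1 ∧ (P e).2 = 0
  south : (P s).2 ≤ -1 ∧ (P s).1 = 0
  north : 1 ≤ (P n).2 ∧ (P n).1 = 0
  general : ∀ a b c, a ≠ b → a ≠ c → b ≠ c → orient (P a) (P b) (P c) ≠ 0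
  separated : ∀ a b, a ≠ b → G.Adj a b → ∀ c d, c ≠ d → a ≠ c → a ≠ d → b ≠ c → b ≠ d →
    G.Adj c d → ¬ (s(a, b) = s(w, e) ∧ s(c, d) = s(s, n)) →
    ¬ (s(a, b) = s(s, n) ∧ s(c, d) = s(w, e)) →
    0 < orient (P a) (P b) (P c) * orient (P a) (P b) (P d) ∨
      0 < orient (P c) (P d) (P a) * orient (P c) (P d) (P b)

namespace AxisCrossing

theorem not_mem_segment (h : AxisCrossing G P w e s n) {a b v : V} (hab : a ≠ b) (ha : v ≠ a)
    (hb : v ≠ b) : toPlane (P v) ∉ segment ℝ (toPlane (P a)) (toPlane (P b)) := fun hv =>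
  h.general a b v hab ha.symm hb.symm <| by
    have := orient_eq_zero_of_mem_segment hv
    rw [orient_toPlane] at this
    exact_mod_cast this

theorem eq_of_shared (h : AxisCrossing G P w e s n) {a b c : V} (hab : a ≠ b) (hac : a ≠ c)
    (hbc : b ≠ c) {x : ℝ × ℝ} (h₁ : x ∈ segment ℝ (toPlane (P a)) (toPlane (P b)))
    (h₂ : x ∈ segment ℝ (toPlane (P a)) (toPlane (P c))) : x = toPlane (P a) :=
  eq_of_mem_segment_of_mem_segment (by
    rw [orient_toPlane]
    exact_mod_cast h.general a b c hab hac hbc) h₁ h₂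

theorem properCross (h : AxisCrossing G P w e s n) :
    ProperCross (edgeSegment (toPlane ∘ P) s(w, e)) (edgeSegment (toPlane ∘ P) s(s, n)) 0 := by
  have hw : toPlane (P w) = (((P w).1 : ℝ), 0) := by simp [toPlane, h.west.2]
  have he : toPlane (P e) = (((P e).1 : ℝ), 0) := by simp [toPlane, h.east.2]
  have hs : toPlane (P s) = (0, ((P s).2 : ℝ)) := by simp [toPlane, h.south.2]
  have hn : toPlane (P n) = (0, ((P n).2 : ℝ)) := by simp [toPlane, h.north.2]
  simp only [edgeSegment_mk, Function.comp_apply, hw, he, hs, hn]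
  exact properCross_segment_axes (by exact_mod_cast h.west.1) (by exact_mod_cast h.east.1)
    (by exact_mod_cast h.south.1) (by exact_mod_cast h.north.1)

theorem eq_zero (h : AxisCrossing G P w e s n) {x : ℝ × ℝ}
    (h₁ : x ∈ edgeSegment (toPlane ∘ P) s(w, e)) (h₂ : x ∈ edgeSegment (toPlane ∘ P) s(s, n)) :
    x = 0 := by
  have h1 := h.west; have h2 := h.east; have h3 := h.south; have h4 := h.north
  rw [edgeSegment_mk] at h₁ h₂
  obtain ⟨t, -, -, e2⟩ := exists_of_mem_segment h₁
  obtain ⟨u, -, e1, -⟩ := exists_of_mem_segment h₂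
  simp only [Function.comp_apply, toPlane, h1.2, h2.2, h3.2, h4.2] at e1 e2
  exact Prod.ext (by simpa using e1) (by simpa using e2)

/-- A common point of two edges with a common end-vertex is that vertex. -/
theorem eq_of_mem_of_mem (h : AxisCrossing G P w e s n) {e₁ e₂ : Sym2 V} (he₁ : e₁ ∈ G.edgeSet)
    (he₂ : e₂ ∈ G.edgeSet) (hne : e₁ ≠ e₂) {x : ℝ × ℝ}
    (h₁ : x ∈ edgeSegment (toPlane ∘ P) e₁) (h₂ : x ∈ edgeSegment (toPlane ∘ P) e₂) {v : V}
    (hv₁ : v ∈ e₁) (hv₂ : v ∈ e₂) : x = toPlane (P v) := by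
  obtain ⟨b, rfl⟩ := hv₁
  obtain ⟨c, rfl⟩ := hv₂
  rw [edgeSegment_mk] at h₁ h₂
  exact h.eq_of_shared he₁.ne he₂.ne (fun hbc : b = c => hne (by rw [hbc])) h₁ h₂

/-- A common point of two straight edges is a common end-vertex or the crossing at the origin. -/
theorem meet (h : AxisCrossing G P w e s n) {e₁ e₂ : Sym2 V} (he₁ : e₁ ∈ G.edgeSet)
    (he₂ : e₂ ∈ G.edgeSet) (hne : e₁ ≠ e₂) {x : ℝ × ℝ}
    (h₁ : x ∈ edgeSegment (toPlane ∘ P) e₁) (h₂ : x ∈ edgeSegment (toPlane ∘ P) e₂) :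
    x ∈ range (toPlane ∘ P) ∨
      x = 0 ∧ (e₁ = s(w, e) ∧ e₂ = s(s, n) ∨ e₁ = s(s, n) ∧ e₂ = s(w, e)) := by
  by_cases hshare : ∃ v, v ∈ e₁ ∧ v ∈ e₂
  · obtain ⟨v, hv₁, hv₂⟩ := hshare
    exact .inl ⟨v, (h.eq_of_mem_of_mem he₁ he₂ hne h₁ h₂ hv₁ hv₂).symm⟩
  by_cases hs₁ : e₁ = s(w, e) ∧ e₂ = s(s, n)
  · exact .inr ⟨h.eq_zero (hs₁.1 ▸ h₁) (hs₁.2 ▸ h₂), .inl hs₁⟩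
  by_cases hs₂ : e₁ = s(s, n) ∧ e₂ = s(w, e)
  · exact .inr ⟨h.eq_zero (hs₂.2 ▸ h₂) (hs₂.1 ▸ h₁), .inr hs₂⟩
  exfalso
  induction e₁ with | _ a b
  induction e₂ with | _ c d
  rw [edgeSegment_mk] at h₁ h₂
  have hsep := h.separated a b he₁.ne he₁ c d he₂.ne
    (fun hh => hshare ⟨a, by simp, by simp [hh]⟩) (fun hh => hshare ⟨a, by simp, by simp [hh]⟩)
    (fun hh => hshare ⟨b, by simp, by simp [hh]⟩) (fun hh => hshare ⟨b, by simp, by simp [hh]⟩)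
    he₂ hs₁ hs₂
  rcases hsep with hs | hs
  · refine disjoint_segment_of_orient ?_ h₁ h₂
    simp only [Function.comp_apply, orient_toPlane]
    exact_mod_cast hs
  · refine disjoint_segment_of_orient ?_ h₂ h₁
    simp only [Function.comp_apply, orient_toPlane]
    exact_mod_cast hs

theorem image_lineMap_eq (f : Sym2 V) :
    AffineMap.lineMap (k := ℝ) (toPlane (P f.out.1)) (toPlane (P f.out.2)) '' Icc 0 1 =
      edgeSegment (toPlane ∘ P) f :=
  (segment_eq_image_lineMap ℝ _ _).symm

/-- The straight-line drawing. -/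
noncomputable def drawing [Finite V] (h : AxisCrossing G P w e s n) : Drawing G where
  pos := toPlane ∘ P
  pos_inj := toPlane_injective.comp h.inj
  arc f := AffineMap.lineMap (toPlane (P (f : Sym2 V).out.1)) (toPlane (P (f : Sym2 V).out.2))
  arc_cont f := AffineMap.lineMap_continuous.continuousOn
  arc_inj f := by
    refine (AffineMap.lineMap_injective ℝ fun hf => ?_).injOn
    refine G.not_isDiag_of_mem_edgeSet f.2 ?_
    rw [← Quot.out_eq (f : Sym2 V)]
    exact h.inj (toPlane_injective hf)
  arc_ends f := ⟨(f : Sym2 V).out.1, (f : Sym2 V).out.2, (Quot.out_eq _).symm, by simp, by simp⟩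
  no_vertex_interior := by
    rintro ⟨f, hf⟩ v hv
    rw [image_lineMap_eq]
    induction f with | _ a b
    rw [edgeSegment_mk]
    rw [Sym2.mem_iff, not_or] at hv
    exact h.not_mem_segment hf.ne hv.1 hv.2
  shared_endpoint e₁ e₂ hne v hv₁ hv₂ x hx := by
    rw [image_lineMap_eq, image_lineMap_eq] at hx
    exact h.eq_of_mem_of_mem e₁.2 e₂.2 (Subtype.coe_injective.ne hne) hx.1 hx.2 hv₁ hv₂
  finite_meet e₁ e₂ hne := by
    refine ((finite_range (toPlane ∘ P)).insert 0).subset fun x hx => ?_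
    rw [image_lineMap_eq, image_lineMap_eq] at hx
    rcases h.meet e₁.2 e₂.2 (Subtype.coe_injective.ne hne) hx.1 hx.2 with hr | ⟨h0, -⟩
    · exact .inr hr
    · exact .inl h0
  proper e₁ e₂ hne p hp hr := by
    rw [image_lineMap_eq, image_lineMap_eq] at hp ⊢
    rcases (h.meet e₁.2 e₂.2 (Subtype.coe_injective.ne hne) hp.1 hp.2).resolve_left hr with
      ⟨rfl, ⟨h1, h2⟩ | ⟨h1, h2⟩⟩
    · rw [h1, h2]
      exact h.properCross
    · rw [h1, h2]
      exact h.properCross.symm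
  at_most_two p hr e₁ e₂ e₃ h₁ h₂ h₃ := by
    rw [image_lineMap_eq] at h₁ h₂ h₃
    by_contra! hcon
    have h12 := (h.meet e₁.2 e₂.2 (Subtype.coe_injective.ne hcon.1) h₁ h₂).resolve_left hr
    have h13 := (h.meet e₁.2 e₃.2 (Subtype.coe_injective.ne hcon.2.1) h₁ h₃).resolve_left hr
    have h23 : (e₂ : Sym2 V) ≠ e₃ := Subtype.coe_injective.ne hcon.2.2
    have h12' : (e₁ : Sym2 V) ≠ e₂ := Subtype.coe_injective.ne hcon.1
    grind

theorem hasOneCrossingDrawing [Finite V] (h : AxisCrossing G P w e s n) :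
    HasOneCrossingDrawing G := by
  have h0 : ∀ p ∈ h.drawing.crossings, p = 0 := by
    rintro p ⟨hr, e₁, e₂, hne, h₁, h₂⟩
    rw [Drawing.arcIm, drawing, image_lineMap_eq] at h₁ h₂
    exact ((h.meet e₁.2 e₂.2 (Subtype.coe_injective.ne hne) h₁ h₂).resolve_left hr).1
  exact ⟨h.drawing, fun p hp q hq => (h0 p hp).trans (h0 q hq).symm⟩

end AxisCrossing

end StraightLine

/-- `K₆` minus two adjacent edges. -/
theorem axisCrossing_adjacent : AxisCrossing
    ((⊤ : SimpleGraph (Fin 6)).deleteEdges {s(0, 1), s(0, 2)})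
    ![(-2, 4), (3, 0), (0, -12), (-12, 0), (0, 3), (9, 9)] 3 1 2 4 where
  inj := by decide +kernel
  west := by decide
  east := by decide
  south := by decide
  north := by decide
  general := by decide +kernel
  separated := by
    simp only [SimpleGraph.deleteEdges_adj, SimpleGraph.top_adj, mem_insert_iff,
      mem_singleton_iff]
    decide +kernel

/-- `K₆` minus two disjoint edges. -/
theorem axisCrossing_disjoint : AxisCrossing
    ((⊤ : SimpleGraph (Fin 6)).deleteEdges {s(0, 1), s(3, 4)})
    ![(9, -12), (0, 3), (-12, 0), (9, 12), (0, -3), (3, 0)] 2 5 4 1 where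
  inj := by decide +kernel
  west := by decide
  east := by decide
  south := by decide
  north := by decide
  general := by decide +kernel
  separated := by
    simp only [SimpleGraph.deleteEdges_adj, SimpleGraph.top_adj, mem_insert_iff,
      mem_singleton_iff]
    decide +kernel

theorem hasOneCrossingDrawing_of_le {V : Type*} [Fintype V] (hV : Fintype.card V = 6)
    {H : SimpleGraph V} {e₁ e₂ : Sym2 V} (h₁ : ¬ e₁.IsDiag) (h₂ : ¬ e₂.IsDiag) (hne : e₁ ≠ e₂)
    (h : H ≤ (⊤ : SimpleGraph V).deleteEdges {e₁, e₂}) : HasOneCrossingDrawing H := by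
  obtain ⟨σ, rfl, hσ⟩ := exists_labelling hV h₁ h₂ hne
  have hmap : ∀ {x y : V} {i j : Fin 6}, s(x, y) ≠ s(σ i, σ j) →
      s(σ.symm x, σ.symm y) ≠ s(i, j) := fun hxy he => hxy <| by
    simpa using congrArg (Sym2.map σ) he
  rcases hσ with rfl | rfl
  · refine axisCrossing_adjacent.hasOneCrossingDrawing.comap ⟨σ.symm, fun {x y} hxy => ?_⟩
      σ.symm.injective
    have h' := h hxy
    simp only [SimpleGraph.deleteEdges_adj, mem_insert_iff, mem_singleton_iff, not_or] at h' ⊢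
    exact ⟨by simpa using hxy.ne, hmap h'.2.1, hmap h'.2.2⟩
  · refine axisCrossing_disjoint.hasOneCrossingDrawing.comap ⟨σ.symm, fun {x y} hxy => ?_⟩
      σ.symm.injective
    have h' := h hxy
    simp only [SimpleGraph.deleteEdges_adj, mem_insert_iff, mem_singleton_iff, not_or] at h' ⊢
    exact ⟨by simpa using hxy.ne, hmap h'.2.1, hmap h'.2.2⟩

/-- The six-vertex graphs minimal without a drawing with at most one crossing are those with
exactly one non-edge. -/
theorem minimal_iff_exists_eq_deleteEdges {V : Type*} [Fintype V] (hV : Fintype.card V = 6)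
    (H : SimpleGraph V) :
    (¬ HasOneCrossingDrawing H ∧
      ∀ e ∈ H.edgeSet, HasOneCrossingDrawing (H.deleteEdges {e})) ↔
      ∃ e : Sym2 V, ¬ e.IsDiag ∧ H = (⊤ : SimpleGraph V).deleteEdges {e} := by
  constructor
  · rintro ⟨hH, hmin⟩
    obtain ⟨a, b, hab, hH'⟩ : ∃ a b, a ≠ b ∧ ¬ H.Adj a b := by
      by_contra! hcon
      obtain rfl : H = ⊤ := by
        ext x y
        exact ⟨fun h => h.ne, hcon x y⟩
      let v : V := (Fintype.equivFinOfCardEq hV).symm 0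
      obtain ⟨f, hf, -⟩ := exists_ne_pair hV s(v, v)
      exact not_hasOneCrossingDrawing hV hf le_rfl (hmin f (by simpa using hf))
    refine ⟨s(a, b), by simpa using hab, le_antisymm ?_ ?_⟩
    · intro x y hxy
      rw [SimpleGraph.deleteEdges_adj]
      exact ⟨hxy.ne, fun he => hH' (by rwa [← SimpleGraph.mem_edgeSet, ← mem_singleton_iff.1 he])⟩
    · intro x y hxy
      rw [SimpleGraph.deleteEdges_adj] at hxy
      by_contra hn
      refine hH (hasOneCrossingDrawing_of_le hV (e₁ := s(a, b)) (e₂ := s(x, y)) (by simpa using hab)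
        (by simpa using hxy.1) (fun he => hxy.2 he.symm) fun u v huv => ?_)
      rw [SimpleGraph.deleteEdges_adj]
      refine ⟨huv.ne, ?_⟩
      rintro (he | he)
      · exact hH' (by rwa [← SimpleGraph.mem_edgeSet, ← he])
      · exact hn (by rwa [← SimpleGraph.mem_edgeSet, ← mem_singleton_iff.1 he])
  · rintro ⟨e, he, rfl⟩
    refine ⟨not_hasOneCrossingDrawing hV he le_rfl, fun f hf => ?_⟩
    have hf' := hf
    rw [SimpleGraph.edgeSet_deleteEdges] at hf'
    refine hasOneCrossingDrawing_of_le hV he (SimpleGraph.not_isDiag_of_mem_edgeSet _ hf)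
      (fun h => hf'.2 h.symm) ?_
    rw [SimpleGraph.deleteEdges_deleteEdges, singleton_union]

theorem exists_iso_deleteEdges_iff {V : Type*} [Fintype V] (hV : Fintype.card V = 6)
    (H : SimpleGraph V) :
    (∃ e ∈ (⊤ : SimpleGraph (Fin 6)).edgeSet,
      Nonempty (H ≃g (⊤ : SimpleGraph (Fin 6)).deleteEdges {e})) ↔
      ∃ e : Sym2 V, ¬ e.IsDiag ∧ H = (⊤ : SimpleGraph V).deleteEdges {e} := by
  have key : ∀ (σ : V ≃ Fin 6) (f : Sym2 V) (x y : V),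
      ((⊤ : SimpleGraph (Fin 6)).deleteEdges {Sym2.map σ f}).Adj (σ x) (σ y) ↔
        ((⊤ : SimpleGraph V).deleteEdges {f}).Adj x y := by
    intro σ f x y
    simp only [SimpleGraph.deleteEdges_adj, SimpleGraph.top_adj, mem_singleton_iff,
      σ.injective.ne_iff, ← Sym2.map_mk, (Sym2.map.injective σ.injective).eq_iff]
  constructor
  · rintro ⟨e, he, ⟨φ⟩⟩
    obtain ⟨f, hf⟩ : ∃ f, Sym2.map φ.toEquiv f = e :=
      ⟨Sym2.map φ.toEquiv.symm e, by
        rw [Sym2.map_map, φ.toEquiv.self_comp_symm, Sym2.map_id, id]⟩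
    refine ⟨f, fun hd => SimpleGraph.not_isDiag_of_mem_edgeSet _ he (hf ▸ hd.map), ?_⟩
    ext x y
    have hxy := key φ.toEquiv f x y
    rw [hf] at hxy
    exact φ.map_adj_iff.symm.trans hxy
  · rintro ⟨f, hf, rfl⟩
    let σ : V ≃ Fin 6 := Fintype.equivFinOfCardEq hV
    refine ⟨Sym2.map σ f, ?_, ⟨⟨σ, fun {x y} => key σ f x y⟩⟩⟩
    rw [SimpleGraph.edgeSet_top]
    exact fun hd => hf ((Sym2.isDiag_map σ.injective).1 hd)

/-- a graph on `6` vertices is a minimum non-NIC-planar graph iff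
it is isomorphic to `K₆` minus one edge, and likewise a graph on `6` vertices is
a minimum non-IC-planar graph iff it is isomorphic to `K₆` minus one edge. -/
theorem stmt17 {V : Type*} [Fintype V] (hV : Fintype.card V = 6)
    (H : SimpleGraph V) :
    (MinNonNICPlanar H ↔
      ∃ e ∈ (⊤ : SimpleGraph (Fin 6)).edgeSet,
        Nonempty (H ≃g (⊤ : SimpleGraph (Fin 6)).deleteEdges {e})) ∧
    (MinNonICPlanar H ↔
      ∃ e ∈ (⊤ : SimpleGraph (Fin 6)).edgeSet,
        Nonempty (H ≃g (⊤ : SimpleGraph (Fin 6)).deleteEdges {e})) := by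
  rw [exists_iso_deleteEdges_iff hV, ← minimal_iff_exists_eq_deleteEdges hV, MinNonNICPlanar,
    MinNonICPlanar]
  simp only [nicPlanar_iff_hasOneCrossingDrawing hV, icPlanar_iff_hasOneCrossingDrawing hV,
    and_self]
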